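/- Let (R, m) be a commutative Noetherian local ring, a an ideal, and M a finitely generated R-module with c = cd(a, M). Then { p ∈ Ass(M) : cd(a, R/p) = dim(R/p) = c } ⊆ Att(H_a^c(M)). Moreover, if c = dim(M), then equality holds. -/

import Mathlib

noncomputable section

universe u

open CategoryTheory

/-- The `i`-th local cohomology of a module with respect to an ideal. -/
abbrev LC {R : Type u} [CommRing R] (J : Ideal R) (i : ℕ) (M : Type u)
    [AddCommGroup M] [Module R M] : ModuleCat.{u} R :=
  (localCohomology J i).obj (ModuleCat.of R M)

/-- Attached primes of a module: primes of the form `Ann(T/U)`. -/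
def Att (R : Type u) [CommRing R] (T : Type u) [AddCommGroup T] [Module R T] :
    Set (Ideal R) :=
  { p | p.IsPrime ∧ ∃ U : Submodule R T, p = Module.annihilator R (T ⧸ U) }

/-- Krull dimension of a module, as the Krull dimension of its support. -/
def mdim (R : Type u) [CommRing R] (M : Type u) [AddCommGroup M] [Module R M] :
    WithBot ℕ∞ :=
  Order.krullDim (Module.support R M)

/-- Cohomological dimension of `M` with respect to `J`:
the supremum of the `i` with `H_J^i(M) ≠ 0` (`⊥` if there are none). -/
def cohDim (R : Type u) [CommRing R] (J : Ideal R) (M : Type u)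
    [AddCommGroup M] [Module R M] : WithBot ℕ∞ :=
  sSup { x | ∃ i : ℕ, x = (i : ℕ∞) ∧ Nontrivial (LC J i M) }

section gen
open Limits
variable {C D : Type*} [Category* C] [Category* D] [Abelian C] [Abelian D] [EnoughProjectives C]

/-- the inclusion of a derived functor in the opcycles -/
def lamE (F : C ⥤ D) [F.Additive] (n : ℕ) {X : C} (P : ProjectiveResolution X) :
    (F.leftDerived n).obj X ⟶
      HomologicalComplex.opcycles ((F.mapHomologicalComplex (ComplexShape.down ℕ)).obj P.complex) n :=
  (P.isoLeftDerivedObj F n).hom ≫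
    HomologicalComplex.homologyι ((F.mapHomologicalComplex (ComplexShape.down ℕ)).obj P.complex) n

def isoD (F : C ⥤ D) [F.Additive] (n : ℕ) {X : C} (P : ProjectiveResolution X) :
    (F.leftDerived n).obj X ≅
      HomologicalComplex.homology ((F.mapHomologicalComplex (ComplexShape.down ℕ)).obj P.complex) n :=
  (P.isoLeftDerivedObj F n)

lemma lamE_eq (F : C ⥤ D) [F.Additive] (n : ℕ) {X : C} (P : ProjectiveResolution X) :
    lamE F n P = (isoD F n P).hom ≫
    HomologicalComplex.homologyι ((F.mapHomologicalComplex (ComplexShape.down ℕ)).obj P.complex) n :=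
  rfl

instance (F : C ⥤ D) [F.Additive] (n : ℕ) {X : C} (P : ProjectiveResolution X) :
    Mono (lamE F n P) := by
  rw [lamE_eq]; infer_instance

lemma lamE_natX (F : C ⥤ D) [F.Additive] (n : ℕ) {X X' : C} (P : ProjectiveResolution X)
    (P' : ProjectiveResolution X') (g : X ⟶ X')
    (φ : ProjectiveResolution.Hom P P' g) :
    lamE F n P ≫ HomologicalComplex.opcyclesMap ((F.mapHomologicalComplex _).map φ.hom) n =
      (F.leftDerived n).map g ≫ lamE F n P' := by
  have h : (F.leftDerived n).map g ≫ (isoD F n P').hom =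
      (isoD F n P).hom ≫ HomologicalComplex.homologyMap ((F.mapHomologicalComplex _).map φ.hom) n :=
    ProjectiveResolution.isoLeftDerivedObj_hom_naturality g P P' φ.hom
      (by rw [φ.hom_f_zero_comp_π_f_zero, ChainComplex.single₀_map_f_zero]; rfl) F n
  rw [lamE_eq, lamE_eq, reassoc_of% h, Category.assoc, HomologicalComplex.homologyι_naturality]

lemma lamE_natY {F G : C ⥤ D} [F.Additive] [G.Additive] (α : F ⟶ G) (n : ℕ) {X : C}
    (P : ProjectiveResolution X) :
    lamE F n P ≫ HomologicalComplex.opcyclesMap ((NatTrans.mapHomologicalComplex α _).app P.complex) n =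
      (NatTrans.leftDerived α n).app X ≫ lamE G n P := by
  have h : (NatTrans.leftDerived α n).app X = (isoD F n P).hom ≫
      HomologicalComplex.homologyMap ((NatTrans.mapHomologicalComplex α _).app P.complex) n ≫
      (isoD G n P).inv :=
    ProjectiveResolution.leftDerived_app_eq α P n
  rw [lamE_eq, lamE_eq, h]
  simp

lemma lamE_exact (F : C ⥤ D) [F.Additive] (n : ℕ) {X : C} (P : ProjectiveResolution X) :
    ∃ w, (ShortComplex.mk (lamE F (n+1) P)
      (HomologicalComplex.fromOpcycles
        ((F.mapHomologicalComplex (ComplexShape.down ℕ)).obj P.complex) (n+1) n) w).Exact := by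
  refine ⟨by rw [lamE_eq, Category.assoc, HomologicalComplex.homologyι_comp_fromOpcycles, comp_zero], ?_⟩
  have k := ShortComplex.exact_of_f_is_kernel (ShortComplex.mk
      (HomologicalComplex.homologyι ((F.mapHomologicalComplex (ComplexShape.down ℕ)).obj P.complex) (n+1))
      (HomologicalComplex.fromOpcycles
        ((F.mapHomologicalComplex (ComplexShape.down ℕ)).obj P.complex) (n+1) n)
        (HomologicalComplex.homologyι_comp_fromOpcycles _ _ _))
      (HomologicalComplex.homologyIsKernel _ (n+1) n (by simp))
  refine ShortComplex.exact_of_iso ?_ k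
  exact ShortComplex.isoMk (isoD F (n+1) P).symm (Iso.refl _)
    (Iso.refl _) (by simp [lamE_eq]) (by simp)

lemma lamE_zero_epi (F : C ⥤ D) [F.Additive] {X : C} (P : ProjectiveResolution X) :
    Epi (lamE F 0 P) := by
  have : IsIso (HomologicalComplex.homologyι
      ((F.mapHomologicalComplex (ComplexShape.down ℕ)).obj P.complex) 0) := by
    apply HomologicalComplex.isIso_homologyι _ _ _ rfl
    apply HomologicalComplex.shape
    simp
  rw [lamE_eq]
  infer_instance

lemma pOp_exact (K : ChainComplex D ℕ) (n : ℕ) :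
    (ShortComplex.mk (K.d (n+1) n) (K.pOpcycles n) (K.d_pOpcycles _ _)).Exact :=
  ShortComplex.exact_of_g_is_cokernel _ (K.opcyclesIsCokernel (n+1) n (by simp))

end gen

section cmp
open Opposite Limits
variable {R : Type u} [CommRing R]

abbrev FY (R : Type u) [CommRing R] (Y : ModuleCat.{u} R) : ModuleCat.{u} R ⥤ (ModuleCat.{u} R)ᵒᵖ :=
  ((linearYoneda R (ModuleCat.{u} R)).obj Y).rightOp

abbrev OE (R : Type u) [CommRing R] (n : ℕ) (X Y : ModuleCat.{u} R) : ModuleCat.{u} R :=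
  ((Ext R (ModuleCat.{u} R) n).obj (op X)).obj Y

abbrev KK {X : ModuleCat.{u} R} (P : ProjectiveResolution X) (Y : ModuleCat.{u} R) :
    ChainComplex (ModuleCat.{u} R)ᵒᵖ ℕ :=
  ((FY R Y).mapHomologicalComplex _).obj P.complex

def prjE (n : ℕ) {X : ModuleCat.{u} R} (P : ProjectiveResolution X) (Y : ModuleCat.{u} R) :
    ((KK P Y).opcycles n).unop ⟶ OE R n X Y :=
  (lamE (FY R Y) n P).unop

def incE (n : ℕ) {X : ModuleCat.{u} R} (P : ProjectiveResolution X) (Y : ModuleCat.{u} R) :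
    ((KK P Y).opcycles n).unop ⟶ ModuleCat.of R (P.complex.X n ⟶ Y) :=
  ((KK P Y).pOpcycles n).unop

lemma exE_natX (n : ℕ) {X X' : ModuleCat.{u} R} (P : ProjectiveResolution X)
    (P' : ProjectiveResolution X') (Y : ModuleCat.{u} R) (g : X ⟶ X')
    (φ : ProjectiveResolution.Hom P P' g) (z : ((KK P' Y).opcycles n).unop) :
    ∃ z', incE n P Y z' = φ.hom.f n ≫ incE n P' Y z ∧
      prjE n P Y z' = ((Ext R (ModuleCat.{u} R) n).map g.op).app Y (prjE n P' Y z) := by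
  refine ⟨(HomologicalComplex.opcyclesMap (((FY R Y).mapHomologicalComplex _).map φ.hom) n).unop z,
    ?_, ?_⟩
  · have := congrArg Quiver.Hom.unop (HomologicalComplex.p_opcyclesMap (((FY R Y).mapHomologicalComplex _).map φ.hom) n)
    exact ConcreteCategory.congr_hom this z
  · have := congrArg Quiver.Hom.unop (lamE_natX (FY R Y) n P P' g φ)
    exact ConcreteCategory.congr_hom this z

lemma exE_natY (n : ℕ) {X : ModuleCat.{u} R} (P : ProjectiveResolution X)
    {Y Y' : ModuleCat.{u} R} (g : Y ⟶ Y') (z : ((KK P Y).opcycles n).unop) :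
    ∃ z', incE n P Y' z' = incE n P Y z ≫ g ∧
      prjE n P Y' z' = ((Ext R (ModuleCat.{u} R) n).obj (op X)).map g (prjE n P Y z) := by
  refine ⟨(HomologicalComplex.opcyclesMap ((NatTrans.mapHomologicalComplex (NatTrans.rightOp ((linearYoneda R (ModuleCat.{u} R)).map g)) _).app P.complex) n).unop z,
    ?_, ?_⟩
  · have := congrArg Quiver.Hom.unop (HomologicalComplex.p_opcyclesMap ((NatTrans.mapHomologicalComplex (NatTrans.rightOp ((linearYoneda R (ModuleCat.{u} R)).map g)) (ComplexShape.down ℕ)).app P.complex) n)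
    exact ConcreteCategory.congr_hom this z
  · have := congrArg Quiver.Hom.unop (lamE_natY (NatTrans.rightOp ((linearYoneda R (ModuleCat.{u} R)).map g)) n P)
    exact ConcreteCategory.congr_hom this z

lemma prjE_surj (n : ℕ) {X : ModuleCat.{u} R} (P : ProjectiveResolution X) (Y : ModuleCat.{u} R) :
    Function.Surjective (prjE n P Y) := by
  rw [← ModuleCat.epi_iff_surjective]
  exact inferInstanceAs (Epi (lamE (FY R Y) n P).unop)

lemma incE_inj (n : ℕ) {X : ModuleCat.{u} R} (P : ProjectiveResolution X) (Y : ModuleCat.{u} R) :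
    Function.Injective (incE n P Y) := by
  rw [← ModuleCat.mono_iff_injective]
  exact inferInstanceAs (Mono ((KK P Y).pOpcycles n).unop)

lemma incE_range (n : ℕ) {X : ModuleCat.{u} R} (P : ProjectiveResolution X) (Y : ModuleCat.{u} R)
    (f : P.complex.X n ⟶ Y) : P.complex.d (n+1) n ≫ f = 0 ↔ ∃ z, incE n P Y z = f := by
  have h2 := (pOp_exact (KK P Y) n).unop
  rw [ShortComplex.moduleCat_exact_iff] at h2
  constructor
  · intro hf
    exact h2 f hf
  · rintro ⟨z, rfl⟩
    have := congrArg Quiver.Hom.unop ((KK P Y).d_pOpcycles (n+1) n)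
    exact ConcreteCategory.congr_hom this z

lemma prjE_ker_succ (n : ℕ) {X : ModuleCat.{u} R} (P : ProjectiveResolution X) (Y : ModuleCat.{u} R)
    (z : ((KK P Y).opcycles (n+1)).unop) : prjE (n+1) P Y z = 0 ↔
      ∃ g : P.complex.X n ⟶ Y, P.complex.d (n+1) n ≫ g = incE (n+1) P Y z := by
  obtain ⟨w, h⟩ := lamE_exact (FY R Y) n P
  have h2 := h.unop
  rw [ShortComplex.moduleCat_exact_iff] at h2
  have h3 (g : P.complex.X n ⟶ Y) : incE (n+1) P Y (((KK P Y).fromOpcycles (n+1) n).unop g) = P.complex.d (n+1) n ≫ g := by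
    have := congrArg Quiver.Hom.unop ((KK P Y).p_fromOpcycles (n+1) n)
    exact ConcreteCategory.congr_hom this g
  constructor
  · intro hz
    obtain ⟨g, hg⟩ := h2 z hz
    refine ⟨g, (h3 g).symm.trans ?_⟩
    exact congrArg (incE (n+1) P Y) hg
  · rintro ⟨g, hg⟩
    rw [← h3] at hg
    rw [← incE_inj _ _ _ hg]
    have := congrArg Quiver.Hom.unop w
    exact ConcreteCategory.congr_hom this g

lemma prjE_ker_zero {X : ModuleCat.{u} R} (P : ProjectiveResolution X) (Y : ModuleCat.{u} R)
    (z : ((KK P Y).opcycles 0).unop) : prjE 0 P Y z = 0 ↔ incE 0 P Y z = 0 := by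
  have := lamE_zero_epi (FY R Y) P
  have : Mono (prjE 0 P Y) := inferInstanceAs (Mono (lamE (FY R Y) 0 P).unop)
  rw [ModuleCat.mono_iff_injective] at this
  rw [map_eq_zero_iff _ this, map_eq_zero_iff _ (incE_inj _ _ _)]
end cmp
section cmp2
open Opposite Limits
variable {R : Type u} [CommRing R]

lemma extMk_zero_iff {X Y : ModuleCat.{u} R} (P : ProjectiveResolution X) (f : P.complex.X 0 ⟶ Y)
    (hf : P.complex.d 1 0 ≫ f = 0) : P.extMk f 1 rfl hf = 0 ↔ f = 0 := by
  constructor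
  · intro h
    rw [← P.extEquivCohomologyClass.apply_eq_iff_eq,
      ProjectiveResolution.extEquivCohomologyClass_extMk,
      ProjectiveResolution.extEquivCohomologyClass_zero,
      CochainComplex.HomComplex.CohomologyClass.mk_eq_zero_iff,
      CochainComplex.HomComplex.Cocycle.toSingleMk_mem_coboundaries_iff _ _ _ _ _ 1 (by simp)] at h
    obtain ⟨g, hg⟩ := h
    have hz : IsZero (P.cochainComplex.X 1) := P.cochainComplex.isZero_of_isStrictlyLE 0 1
    rw [hz.eq_of_src g 0, comp_zero] at hg
    rw [← cancel_epi (P.cochainComplexXIso (-(0:ℕ)) 0 rfl).hom, comp_zero]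
    exact hg.symm
  · rintro rfl
    simp

def newE (n : ℕ) {X : ModuleCat.{u} R} (P : ProjectiveResolution X) (Y : ModuleCat.{u} R) :
    ((KK P Y).opcycles n).unop →ₗ[R] Abelian.Ext X Y n where
  toFun z := P.extMk (incE n P Y z) (n+1) rfl ((incE_range n P Y _).2 ⟨z, rfl⟩)
  map_add' z w := by
    rw [ProjectiveResolution.add_extMk]
    congr 1
    exact map_add _ _ _
  map_smul' r z := by
    rw [RingHom.id_apply, Abelian.Ext.smul_eq_comp_mk₀, ProjectiveResolution.extMk_comp_mk₀]
    congr 1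
    rw [Linear.comp_smul, Category.comp_id]
    exact map_smul _ _ _

lemma newE_ker (n : ℕ) {X : ModuleCat.{u} R} (P : ProjectiveResolution X) (Y : ModuleCat.{u} R)
    (z : ((KK P Y).opcycles n).unop) : newE n P Y z = 0 ↔ prjE n P Y z = 0 := by
  cases n with
  | zero => rw [prjE_ker_zero]; exact extMk_zero_iff _ _ ((incE_range 0 P Y _).2 ⟨z, rfl⟩)
  | succ n => rw [prjE_ker_succ]; exact ProjectiveResolution.extMk_eq_zero_iff _ _ _ rfl ((incE_range (n+1) P Y _).2 ⟨z, rfl⟩) _ rfl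

lemma newE_surj (n : ℕ) {X : ModuleCat.{u} R} (P : ProjectiveResolution X) (Y : ModuleCat.{u} R) :
    Function.Surjective (newE n P Y) := by
  intro e
  obtain ⟨f, hf, rfl⟩ := P.extMk_surjective e (n+1) rfl
  obtain ⟨z, rfl⟩ := (incE_range n P Y f).1 hf
  exact ⟨z, rfl⟩

/-- Comparison of the two definitions of Ext. -/
def cmpE (n : ℕ) (X Y : ModuleCat.{u} R) : OE R n X Y ≃ₗ[R] Abelian.Ext X Y n :=
  ((prjE n (projectiveResolution X) Y).hom.quotKerEquivOfSurjective (prjE_surj _ _ _)).symm ≪≫ₗ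
  Submodule.quotEquivOfEq _ _ (by
    ext z
    exact (newE_ker n (projectiveResolution X) Y z).symm) ≪≫ₗ
  (newE n (projectiveResolution X) Y).quotKerEquivOfSurjective (newE_surj _ _ _)

lemma cmpE_prjE (n : ℕ) (X Y : ModuleCat.{u} R)
    (z : ((KK (projectiveResolution X) Y).opcycles n).unop) :
    cmpE n X Y (prjE n (projectiveResolution X) Y z) = newE n (projectiveResolution X) Y z := by
  have : ((prjE n (projectiveResolution X) Y).hom.quotKerEquivOfSurjective (prjE_surj _ _ _)).symm
    (prjE n (projectiveResolution X) Y z) = Submodule.Quotient.mk z := by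
    rw [LinearEquiv.symm_apply_eq]
    rfl
  simp only [cmpE, LinearEquiv.trans_apply]
  rw [this]
  rfl

lemma newE_eq (n : ℕ) {X Y : ModuleCat.{u} R} (P : ProjectiveResolution X)
    (z : ((KK P Y).opcycles n).unop) (f) (hf : P.complex.d (n+1) n ≫ f = 0)
    (h : incE n P Y z = f) : newE n P Y z = P.extMk f (n+1) rfl hf := by
  subst h; rfl

lemma cmpE_natX (n : ℕ) {X X' Y : ModuleCat.{u} R} (g : X ⟶ X') (e : OE R n X' Y) :
    cmpE n X Y (((Ext R (ModuleCat.{u} R) n).map g.op).app Y e) =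
      (Abelian.Ext.mk₀ g).comp (cmpE n X' Y e) (zero_add _) := by
  obtain ⟨z, rfl⟩ := prjE_surj n (projectiveResolution X') Y e
  let φ : ProjectiveResolution.Hom (projectiveResolution X) (projectiveResolution X') g :=
    ⟨ProjectiveResolution.lift g _ _, by
      rw [ProjectiveResolution.lift_commutes_zero, ChainComplex.single₀_map_f_zero]; rfl⟩
  obtain ⟨z', h1, h2⟩ := exE_natX n _ _ Y g φ z
  rw [← h2, cmpE_prjE, cmpE_prjE]
  refine Eq.trans ?_ (ProjectiveResolution.mk₀_comp_extMk (incE n (projectiveResolution X') Y z) (n+1) rfl ((incE_range n _ Y _).2 ⟨z, rfl⟩) φ).symm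
  exact newE_eq _ _ _ _ _ h1

lemma cmpE_natY (n : ℕ) {X Y Y' : ModuleCat.{u} R} (g : Y ⟶ Y') (e : OE R n X Y) :
    cmpE n X Y' (((Ext R (ModuleCat.{u} R) n).obj (op X)).map g e) =
      (cmpE n X Y e).comp (Abelian.Ext.mk₀ g) (add_zero _) := by
  obtain ⟨z, rfl⟩ := prjE_surj n (projectiveResolution X) Y e
  obtain ⟨z', h1, h2⟩ := exE_natY n _ g z
  rw [← h2, cmpE_prjE, cmpE_prjE]
  refine Eq.trans ?_ (ProjectiveResolution.extMk_comp_mk₀ _ (incE n (projectiveResolution X) Y z) (n+1) rfl ((incE_range n _ Y _).2 ⟨z, rfl⟩) g).symm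
  exact newE_eq _ _ _ _ _ h1
end cmp2
section colim
open Opposite Limits
variable {R : Type u} [CommRing R]

/-- the module R/a^t -/
abbrev RQ (a : Ideal R) (t : ℕ) : ModuleCat.{u} R := ModuleCat.of R (R ⧸ a ^ t)

def rq (a : Ideal R) {t s : ℕ} (h : t ≤ s) : RQ a s ⟶ RQ a t :=
  ModuleCat.ofHom (Submodule.mapQ _ _ LinearMap.id (Ideal.pow_le_pow_right h))

def iotaO (a : Ideal R) (i t : ℕ) (N : ModuleCat.{u} R) :
    OE R i (RQ a t) N ⟶ (localCohomology a i).obj N :=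
  have := localCohomology.hasColimitDiagram.{u, 0} (localCohomology.idealPowersDiagram a) i
  (colimit.ι (localCohomology.diagram (localCohomology.idealPowersDiagram a) i) (op (op t))).app N

lemma iotaO_natY (a : Ideal R) (i t : ℕ) {N N' : ModuleCat.{u} R} (g : N ⟶ N') :
    ((Ext R (ModuleCat.{u} R) i).obj (op (RQ a t))).map g ≫ iotaO a i t N' =
      iotaO a i t N ≫ (localCohomology a i).map g := by
  have := localCohomology.hasColimitDiagram.{u, 0} (localCohomology.idealPowersDiagram a) i
  exact (colimit.ι (localCohomology.diagram (localCohomology.idealPowersDiagram a) i) (op (op t))).naturality g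

lemma iotaO_w (a : Ideal R) (i : ℕ) {t s : ℕ} (h : t ≤ s) (N : ModuleCat.{u} R) :
    ((Ext R (ModuleCat.{u} R) i).map (rq a h).op).app N ≫ iotaO a i s N = iotaO a i t N := by
  have := localCohomology.hasColimitDiagram.{u, 0} (localCohomology.idealPowersDiagram a) i
  exact congrArg (fun f => NatTrans.app f N) (colimit.w (localCohomology.diagram (localCohomology.idealPowersDiagram a) i) ((homOfLE h).op.op : op (op t) ⟶ op (op s)))

def lcCocone (a : Ideal R) (i : ℕ) (N : ModuleCat.{u} R) :
    Cocone (localCohomology.diagram (localCohomology.idealPowersDiagram a) i ⋙ (evaluation _ _).obj N) :=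
  have := localCohomology.hasColimitDiagram.{u, 0} (localCohomology.idealPowersDiagram a) i
  ((evaluation _ _).obj N).mapCocone (colimit.cocone (localCohomology.diagram (localCohomology.idealPowersDiagram a) i))

def lcIsColim (a : Ideal R) (i : ℕ) (N : ModuleCat.{u} R) : IsColimit (lcCocone a i N) :=
  have := localCohomology.hasColimitDiagram.{u, 0} (localCohomology.idealPowersDiagram a) i
  isColimitOfPreserves ((evaluation _ _).obj N) (colimit.isColimit _)

lemma presF : PreservesFilteredColimitsOfSize.{0, 0} (forget (ModuleCat.{u} R)) :=
  preservesFilteredColimitsOfSize_shrink.{0, u, 0, u} _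

lemma iotaO_surj (a : Ideal R) (i : ℕ) (N : ModuleCat.{u} R) (x : (localCohomology a i).obj N) :
    ∃ t, ∃ e : OE R i (RQ a t) N, iotaO a i t N e = x := by
  have := presF (R := R)
  obtain ⟨j, y, h⟩ := Concrete.isColimit_exists_rep _ (lcIsColim a i N) x
  exact ⟨unop (unop j), y, h⟩

lemma iotaO_zero (a : Ideal R) (i t : ℕ) (N : ModuleCat.{u} R) (e : OE R i (RQ a t) N)
    (he : iotaO a i t N e = 0) : ∃ s, ∃ h : t ≤ s,
      ((Ext R (ModuleCat.{u} R) i).map (rq a h).op).app N e = 0 := by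
  have := presF (R := R)
  obtain ⟨k, f, g, h⟩ := Concrete.isColimit_exists_of_rep_eq _ (lcIsColim a i N) (i := op (op t)) (j := op (op t)) e 0
    (he.trans (map_zero (iotaO a i t N).hom).symm)
  refine ⟨unop (unop k), leOfHom f.unop.unop, ?_⟩
  exact h.trans (map_zero _)

/-- the structure maps from Ext -/
def iota (a : Ideal R) (i t : ℕ) (N : ModuleCat.{u} R) :
    Abelian.Ext (RQ a t) N i →ₗ[R] (localCohomology a i).obj N :=
  (iotaO a i t N).hom ∘ₗ (cmpE i (RQ a t) N).symm.toLinearMap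

lemma iota_cmp (a : Ideal R) (i t : ℕ) (N : ModuleCat.{u} R) (e : OE R i (RQ a t) N) :
    iota a i t N (cmpE i _ _ e) = iotaO a i t N e := by
  simp [iota]

lemma iota_surj (a : Ideal R) (i : ℕ) (N : ModuleCat.{u} R) (x : (localCohomology a i).obj N) :
    ∃ t, ∃ e : Abelian.Ext (RQ a t) N i, iota a i t N e = x := by
  obtain ⟨t, e, rfl⟩ := iotaO_surj a i N x
  exact ⟨t, _, iota_cmp _ _ _ _ _⟩

/-- restriction -/
abbrev rs (a : Ideal R) {i t s : ℕ} (h : t ≤ s) {N : ModuleCat.{u} R} (e : Abelian.Ext (RQ a t) N i) :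
    Abelian.Ext (RQ a s) N i := (Abelian.Ext.mk₀ (rq a h)).comp e (zero_add _)

lemma iota_rs (a : Ideal R) {i t s : ℕ} (h : t ≤ s) {N : ModuleCat.{u} R}
    (e : Abelian.Ext (RQ a t) N i) : iota a i s N (rs a h e) = iota a i t N e := by
  obtain ⟨e, rfl⟩ := (cmpE i _ _).surjective e
  rw [rs, ← cmpE_natX, iota_cmp, iota_cmp, ← iotaO_w a i h N]
  rfl

lemma iota_zero (a : Ideal R) {i t : ℕ} {N : ModuleCat.{u} R} {e : Abelian.Ext (RQ a t) N i}
    (he : iota a i t N e = 0) : ∃ s, ∃ h : t ≤ s, rs a h e = 0 := by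
  obtain ⟨e, rfl⟩ := (cmpE i _ _).surjective e
  rw [iota_cmp] at he
  obtain ⟨s, h, h'⟩ := iotaO_zero a i t N e he
  exact ⟨s, h, by rw [rs, ← cmpE_natX, h', map_zero]⟩

lemma iota_nat (a : Ideal R) {i t : ℕ} {N N' : ModuleCat.{u} R} (g : N ⟶ N')
    (e : Abelian.Ext (RQ a t) N i) :
    (localCohomology a i).map g (iota a i t N e) =
      iota a i t N' (e.comp (Abelian.Ext.mk₀ g) (add_zero _)) := by
  obtain ⟨e, rfl⟩ := (cmpE i _ _).surjective e
  rw [← cmpE_natY, iota_cmp, iota_cmp]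
  exact (congrArg (fun f => f.hom e) (iotaO_natY a i t g)).symm
end colim
section iface
open Opposite Limits
variable {R : Type u} [CommRing R]
variable {A B C : Type u} [AddCommGroup A] [Module R A] [AddCommGroup B] [Module R B]
  [AddCommGroup C] [Module R C]

/-- functoriality of local cohomology -/
def LCmap (a : Ideal R) (i : ℕ) (f : A →ₗ[R] B) : LC a i A →ₗ[R] LC a i B :=
  ((localCohomology a i).map (ModuleCat.ofHom f)).hom

lemma LCmap_iota (a : Ideal R) {i t : ℕ} (f : A →ₗ[R] B) (e : Abelian.Ext (RQ a t) (ModuleCat.of R A) i) :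
    LCmap a i f (iota a i t _ e) =
      iota a i t _ (e.comp (Abelian.Ext.mk₀ (ModuleCat.ofHom f)) (add_zero _)) :=
  iota_nat a (ModuleCat.ofHom f) e

lemma LCmap_comp (a : Ideal R) (i : ℕ) (f : A →ₗ[R] B) (g : B →ₗ[R] C) (x : LC a i A) :
    LCmap a i (g ∘ₗ f) x = LCmap a i g (LCmap a i f x) := by
  have : ModuleCat.ofHom (g ∘ₗ f) = ModuleCat.ofHom f ≫ ModuleCat.ofHom g := rfl
  simp only [LCmap, this, Functor.map_comp]
  rfl

lemma LCmap_id (a : Ideal R) (i : ℕ) (x : LC a i A) :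
    LCmap a i LinearMap.id x = x := by
  have : ModuleCat.ofHom (LinearMap.id : A →ₗ[R] A) = 𝟙 _ := rfl
  simp only [LCmap, this, CategoryTheory.Functor.map_id]
  rfl

lemma LCmap_add (a : Ideal R) (i : ℕ) (f g : A →ₗ[R] B) (x : LC a i A) :
    LCmap a i (f + g) x = LCmap a i f x + LCmap a i g x := by
  obtain ⟨t, e, rfl⟩ := iota_surj a i _ x
  rw [LCmap_iota, LCmap_iota, LCmap_iota, ← map_add, ModuleCat.ofHom_add, Abelian.Ext.mk₀_add, Abelian.Ext.comp_add]

lemma LCmap_smul (a : Ideal R) (i : ℕ) (r : R) (f : A →ₗ[R] B) (x : LC a i A) :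
    LCmap a i (r • f) x = r • LCmap a i f x := by
  obtain ⟨t, e, rfl⟩ := iota_surj a i _ x
  rw [LCmap_iota, LCmap_iota, ← map_smul, ← Abelian.Ext.comp_smul, ← Abelian.Ext.mk₀_smul]
  rfl

lemma LCmap_zero (a : Ideal R) (i : ℕ) (x : LC a i A) :
    LCmap a i (0 : A →ₗ[R] B) x = 0 := by
  have := LCmap_smul a i 0 (0 : A →ₗ[R] B) x
  rwa [zero_smul, zero_smul] at this

lemma LC_torsion (a : Ideal R) (i : ℕ) (x : LC a i A) : ∃ t : ℕ, ∀ r ∈ a ^ t, r • x = 0 := by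
  obtain ⟨t, e, rfl⟩ := iota_surj a i _ x
  refine ⟨t, fun r hr => ?_⟩
  have h : r • e = 0 := by
    have h0 : r • 𝟙 (RQ a t) = 0 := by
      refine ModuleCat.hom_ext (LinearMap.ext fun y => ?_)
      obtain ⟨y, rfl⟩ := Ideal.Quotient.mk_surjective y
      change Ideal.Quotient.mk (a ^ t) (r * y) = 0
      exact Ideal.Quotient.eq_zero_iff_mem.2 (Ideal.mul_mem_right _ _ hr)
    have h1 : (Abelian.Ext.mk₀ (r • 𝟙 (RQ a t))).comp e (zero_add _) = r • e := by
      rw [Abelian.Ext.mk₀_smul, Abelian.Ext.smul_comp, Abelian.Ext.mk₀_id_comp]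
    rw [← h1, h0, Abelian.Ext.mk₀_zero, Abelian.Ext.zero_comp]
  rw [← map_smul, h, map_zero]

lemma sesZ {f : A →ₗ[R] B} {g : B →ₗ[R] C} (hfg : Function.Exact f g) :
  ModuleCat.ofHom f ≫ ModuleCat.ofHom g = 0 := by
  ext x; exact hfg.apply_apply_eq_zero x

lemma ses {f : A →ₗ[R] B} {g : B →ₗ[R] C} (hf : Function.Injective f) (hg : Function.Surjective g)
    (hfg : Function.Exact f g) :
    (ShortComplex.mk (ModuleCat.ofHom f) (ModuleCat.ofHom g) (sesZ hfg)).ShortExact :=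
  ModuleCat.shortComplex_shortExact _ hfg hf hg

lemma LC_exact (a : Ideal R) (i : ℕ) {f : A →ₗ[R] B} {g : B →ₗ[R] C} (hf : Function.Injective f)
    (hg : Function.Surjective g) (hfg : Function.Exact f g) :
    Function.Exact (LCmap a i f) (LCmap a i g) := by
  intro x
  constructor
  · intro hx
    obtain ⟨t, e, rfl⟩ := iota_surj a i _ x
    rw [LCmap_iota] at hx
    obtain ⟨s, h, hx⟩ := iota_zero a hx
    obtain ⟨y, hy⟩ := Abelian.Ext.covariant_sequence_exact₂ _ (ses hf hg hfg) (rs a h e)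
      (by rw [← hx]; exact Abelian.Ext.comp_assoc_of_third_deg_zero _ _ _ _)
    exact ⟨iota a i s _ y, by rw [LCmap_iota, ← iota_rs a h e]; exact congrArg _ hy⟩
  · rintro ⟨y, rfl⟩
    rw [← LCmap_comp, show g ∘ₗ f = 0 from hfg.linearMap_comp_eq_zero, LCmap_zero]

lemma LC_surj (a : Ideal R) (i : ℕ) {f : A →ₗ[R] B} {g : B →ₗ[R] C} (hf : Function.Injective f)
    (hg : Function.Surjective g) (hfg : Function.Exact f g) (hA : Subsingleton (LC a (i+1) A)) :
    Function.Surjective (LCmap a i g) := by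
  intro x
  obtain ⟨t, e, rfl⟩ := iota_surj a i _ x
  obtain ⟨s, h, hx⟩ := iota_zero a (e := e.comp (ses hf hg hfg).extClass rfl) (Subsingleton.elim _ _)
  obtain ⟨y, hy⟩ := Abelian.Ext.covariant_sequence_exact₃ _ (ses hf hg hfg) (rs a h e) rfl
      (by rw [← hx]; exact Abelian.Ext.comp_assoc _ _ _ _ _ (by lia))
  exact ⟨iota a i s _ y, by rw [LCmap_iota, ← iota_rs a h e]; exact congrArg _ hy⟩

lemma LC_inj (a : Ideal R) (i : ℕ) {f : A →ₗ[R] B} {g : B →ₗ[R] C} (hf : Function.Injective f)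
    (hg : Function.Surjective g) (hfg : Function.Exact f g) (hC : Subsingleton (LC a i C)) :
    Function.Injective (LCmap a (i+1) f) := by
  rw [injective_iff_map_eq_zero]
  intro x hx
  obtain ⟨t, e, rfl⟩ := iota_surj a (i+1) _ x
  rw [LCmap_iota] at hx
  obtain ⟨s, h, hx⟩ := iota_zero a hx
  obtain ⟨y, hy⟩ := Abelian.Ext.covariant_sequence_exact₁ _ (ses hf hg hfg) (rs a h e)
      (by rw [← hx]; exact Abelian.Ext.comp_assoc_of_third_deg_zero _ _ _ _) rfl
  obtain ⟨s', h', hx'⟩ := iota_zero a (e := y) (Subsingleton.elim _ _)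
  rw [← iota_rs a h, ← iota_rs a h']
  have : rs a h' (rs a h e) = (rs a h' y).comp (ses hf hg hfg).extClass rfl := by
    rw [← hy]; exact (Abelian.Ext.comp_assoc _ _ _ _ _ (by lia)).symm
  rw [this, hx', Abelian.Ext.zero_comp, map_zero]

lemma LC_subs_mid (a : Ideal R) (i : ℕ) {f : A →ₗ[R] B} {g : B →ₗ[R] C} (hf : Function.Injective f)
    (hg : Function.Surjective g) (hfg : Function.Exact f g) (hA : Subsingleton (LC a i A))
    (hC : Subsingleton (LC a i C)) : Subsingleton (LC a i B) := by
  refine subsingleton_of_forall_eq 0 fun x => ?_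
  obtain ⟨y, rfl⟩ := (LC_exact a i hf hg hfg x).1 (Subsingleton.elim _ _)
  rw [Subsingleton.elim y 0, map_zero]

lemma LC_congr (a : Ideal R) (i : ℕ) (e : A ≃ₗ[R] B) (hA : Subsingleton (LC a i A)) :
    Subsingleton (LC a i B) := by
  refine subsingleton_of_forall_eq 0 fun x => ?_
  have : LCmap a i (e.toLinearMap ∘ₗ e.symm.toLinearMap) x = x := by
    rw [LinearEquiv.comp_symm, LCmap_id]
  rw [← this, LCmap_comp, Subsingleton.elim (LCmap a i _ x) 0, map_zero]

lemma LC_subsingleton (a : Ideal R) (i : ℕ) [Subsingleton A] : Subsingleton (LC a i A) := by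
  refine subsingleton_of_forall_eq 0 fun x => ?_
  have := LCmap_id a i x
  rw [Subsingleton.elim (LinearMap.id : A →ₗ[R] A) 0, LCmap_zero] at this
  exact this.symm

/-- base step for torsion vanishing -/
lemma LC_one_of_lift (a : Ideal R) {f : A →ₗ[R] B} {g : B →ₗ[R] C} (hf : Function.Injective f)
    (hg : Function.Surjective g) (hfg : Function.Exact f g)
    (hB : ∀ b : B, ∃ t : ℕ, ∀ r ∈ a ^ t, r • b = 0)
    [Injective (ModuleCat.of R B)] : Subsingleton (LC a 1 A) := by
  refine subsingleton_of_forall_eq 0 fun x => ?_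
  obtain ⟨t, e, rfl⟩ := iota_surj a 1 _ x
  obtain ⟨y, hy⟩ := Abelian.Ext.covariant_sequence_exact₁ _ (ses hf hg hfg) e
      (Abelian.Ext.eq_zero_of_injective _) (n₀ := 0) rfl
  obtain ⟨φ, rfl⟩ := (Abelian.Ext.mk₀_bijective _ _).2 y
  obtain ⟨b, hb⟩ := hg (φ.hom (Ideal.Quotient.mk (a ^ t) 1))
  obtain ⟨s, hs⟩ := hB b
  have hle : t ≤ max t s := le_max_left _ _
  let ψ : RQ a (max t s) ⟶ ModuleCat.of R B := ModuleCat.ofHom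
    (Submodule.liftQ _ (LinearMap.toSpanSingleton R B b) (fun r hr => by
      simpa using hs r (Ideal.pow_le_pow_right (le_max_right t s) hr)))
  have hψ : rq a hle ≫ φ = ψ ≫ ModuleCat.ofHom g := by
    refine ModuleCat.hom_ext (LinearMap.ext fun z => ?_)
    obtain ⟨z, rfl⟩ := Ideal.Quotient.mk_surjective z
    change φ.hom (Ideal.Quotient.mk (a ^ t) z) = g (z • b)
    rw [map_smul, hb, ← map_smul]
    congr 1
    change _ = Ideal.Quotient.mk (a ^ t) (z * 1)
    rw [mul_one]
  rw [← iota_rs a hle]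
  have : rs a hle e = 0 := by
    rw [← hy, rs]
    rw [← Abelian.Ext.comp_assoc _ _ _ (zero_add 0) _ (by lia), Abelian.Ext.mk₀_comp_mk₀, hψ,
      ← Abelian.Ext.mk₀_comp_mk₀, Abelian.Ext.comp_assoc _ _ _ _ (zero_add 1) (by lia)]
    have := (ses hf hg hfg).comp_extClass
    dsimp only at this
    rw [this, Abelian.Ext.comp_zero]
  rw [this, map_zero]

lemma LC_succ_of_inj (a : Ideal R) (i : ℕ) {f : A →ₗ[R] B} {g : B →ₗ[R] C} (hf : Function.Injective f)
    (hg : Function.Surjective g) (hfg : Function.Exact f g)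
    [Injective (ModuleCat.of R B)] (hC : Subsingleton (LC a i C)) : Subsingleton (LC a (i+1) A) := by
  refine subsingleton_of_forall_eq 0 fun x => LC_inj a i hf hg hfg hC ?_
  obtain ⟨t, e, rfl⟩ := iota_surj a _ _ x
  rw [LCmap_iota, Abelian.Ext.eq_zero_of_injective (e.comp _ _), map_zero, map_zero]
end iface
section tors
variable {R : Type u} [CommRing R]

/-- the torsion submodule -/
def Gam (a : Ideal R) (E : Type u) [AddCommGroup E] [Module R E] : Submodule R E where
  carrier := {e | ∃ t : ℕ, ∀ r ∈ a ^ t, r • e = 0}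
  zero_mem' := ⟨0, by simp⟩
  add_mem' := by
    rintro x y ⟨t, ht⟩ ⟨s, hs⟩
    refine ⟨max t s, fun r hr => ?_⟩
    rw [smul_add, ht r (Ideal.pow_le_pow_right (le_max_left t s) hr),
      hs r (Ideal.pow_le_pow_right (le_max_right t s) hr), add_zero]
  smul_mem' := by
    rintro c x ⟨t, ht⟩
    exact ⟨t, fun r hr => by rw [smul_comm, ht r hr, smul_zero]⟩

lemma Gam_fg (a : Ideal R) {E : Type u} [AddCommGroup E] [Module R E] (L : Submodule R E)
    (hL : L.FG) (h : L ≤ Gam a E) : ∃ t : ℕ, ∀ r ∈ a ^ t, ∀ x ∈ L, r • x = 0 := by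
  obtain ⟨S, rfl⟩ := hL
  have : ∀ x ∈ S, ∃ t : ℕ, ∀ r ∈ a ^ t, r • x = 0 := fun x hx => h (Submodule.subset_span hx)
  choose! t ht using this
  refine ⟨S.sup t, fun r hr x hx => ?_⟩
  induction hx using Submodule.span_induction with
  | mem x hx => exact ht x hx r (Ideal.pow_le_pow_right (Finset.le_sup hx) hr)
  | zero => simp
  | add x y _ _ h1 h2 => rw [smul_add, h1, h2, add_zero]
  | smul c x _ h1 => rw [smul_comm, h1, smul_zero]

lemma Gam_injective [IsNoetherianRing R] (a : Ideal R) (E : Type u) [AddCommGroup E] [Module R E]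
    [hE : Module.Injective R E] : Module.Injective R (Gam a E) := by
  apply Module.Baer.injective
  intro I g
  obtain ⟨t, ht⟩ := Gam_fg a (LinearMap.range ((Gam a E).subtype ∘ₗ g))
    (by
      rw [← Submodule.map_top]; exact (IsNoetherian.noetherian (⊤ : Submodule R I)).map _) (by rintro _ ⟨x, rfl⟩; exact (g x).2)
  obtain ⟨k, hk⟩ := Ideal.exists_pow_inf_eq_pow_smul a (M := R) I
  have hk := hk (k + t) (by lia)
  let j : I →ₗ[R] R ⧸ a ^ (k + t) := (Submodule.mkQ _) ∘ₗ I.subtype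
  have hg : LinearMap.ker j ≤ LinearMap.ker ((Gam a E).subtype ∘ₗ g) := by
    intro x hx
    have hx1 : (x : R) ∈ a ^ (k + t) := Ideal.Quotient.eq_zero_iff_mem.1 hx
    have hx2 : (x : R) ∈ a ^ t • I := by
      have : (x : R) ∈ a ^ (k + t) • (⊤ : Submodule R R) ⊓ I := ⟨by simpa using hx1, x.2⟩
      rw [hk] at this
      rw [Nat.add_sub_cancel_left] at this
      exact Submodule.smul_mono le_rfl inf_le_right this
    have key : ∀ y ∈ a ^ t • I, ∃ hy : y ∈ I, ((g ⟨y, hy⟩ : Gam a E) : E) = 0 := by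
      intro y hy
      refine Submodule.smul_induction_on hy ?_ ?_
      · intro r hr n hn
        refine ⟨I.smul_mem r hn, ?_⟩
        have : (⟨r • n, I.smul_mem r hn⟩ : I) = r • ⟨n, hn⟩ := rfl
        rw [this, map_smul]
        exact ht r hr _ ⟨_, rfl⟩
      · rintro x y ⟨hx, hx'⟩ ⟨hy, hy'⟩
        refine ⟨I.add_mem hx hy, ?_⟩
        have : (⟨x + y, I.add_mem hx hy⟩ : I) = ⟨x, hx⟩ + ⟨y, hy⟩ := rfl
        rw [this, map_add, Submodule.coe_add, hx', hy', add_zero]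
    exact (key x hx2).2
  obtain ⟨h, hh⟩ := hE.out ((LinearMap.ker j).liftQ j le_rfl)
    (LinearMap.ker_eq_bot.1 (Submodule.ker_liftQ_eq_bot _ _ _ le_rfl))
    ((LinearMap.ker j).liftQ ((Gam a E).subtype ∘ₗ g) hg)
  have h1 : ∀ r : R, h (Submodule.Quotient.mk r) = r • h (Submodule.Quotient.mk 1) := by
    intro r
    rw [← map_smul, ← Submodule.Quotient.mk_smul, smul_eq_mul, mul_one]
  have he : h (Submodule.Quotient.mk 1) ∈ Gam a E := by
    refine ⟨k + t, fun r hr => ?_⟩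
    rw [← h1, (Submodule.Quotient.mk_eq_zero _).2 hr, map_zero]
  refine ⟨LinearMap.toSpanSingleton R _ ⟨_, he⟩, fun x hx => Subtype.ext ?_⟩
  have := hh (Submodule.Quotient.mk ⟨x, hx⟩)
  refine Eq.trans ?_ this
  exact (h1 x).symm

lemma LC_of_torsion [IsNoetherianRing R] (a : Ideal R) (i : ℕ) : ∀ (N : Type u) [AddCommGroup N] [Module R N],
    (∀ x : N, ∃ t : ℕ, ∀ r ∈ a ^ t, r • x = 0) → Subsingleton (LC a (i+1) N) := by
  induction i with
  | zero =>
    intro N _ _ hN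
    let E := Injective.under (ModuleCat.of R N)
    have : Module.Injective R E := (Module.injective_iff_injective_object R E).2 (Injective.injective_under (ModuleCat.of R N))
    have := Gam_injective a E
    have : Injective (ModuleCat.of R (Gam a E)) := (Module.injective_iff_injective_object R _).1 inferInstance
    let f : N →ₗ[R] Gam a E := LinearMap.codRestrict _ (Injective.ι (ModuleCat.of R N)).hom (fun x => by
      obtain ⟨t, ht⟩ := hN x
      exact ⟨t, fun r hr => by rw [← map_smul, ht r hr, map_zero]⟩)
    have hf : Function.Injective f := by
      intro x y hxy
      exact (ModuleCat.mono_iff_injective (Injective.ι (ModuleCat.of R N))).1 inferInstance (congrArg Subtype.val hxy)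
    exact LC_one_of_lift a hf (Submodule.mkQ_surjective (LinearMap.range f))
      (LinearMap.exact_map_mkQ_range f) (fun b => by
        obtain ⟨t, ht⟩ := b.2
        exact ⟨t, fun r hr => Subtype.ext (ht r hr)⟩)
  | succ i ih =>
    intro N _ _ hN
    let E := Injective.under (ModuleCat.of R N)
    have : Module.Injective R E := (Module.injective_iff_injective_object R E).2 (Injective.injective_under (ModuleCat.of R N))
    have := Gam_injective a E
    have : Injective (ModuleCat.of R (Gam a E)) := (Module.injective_iff_injective_object R _).1 inferInstance
    let f : N →ₗ[R] Gam a E := LinearMap.codRestrict _ (Injective.ι (ModuleCat.of R N)).hom (fun x => by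
      obtain ⟨t, ht⟩ := hN x
      exact ⟨t, fun r hr => by rw [← map_smul, ht r hr, map_zero]⟩)
    have hf : Function.Injective f := by
      intro x y hxy
      exact (ModuleCat.mono_iff_injective (Injective.ι (ModuleCat.of R N))).1 inferInstance (congrArg Subtype.val hxy)
    refine LC_succ_of_inj a _ hf (Submodule.mkQ_surjective (LinearMap.range f))
      (LinearMap.exact_map_mkQ_range f) (ih _ fun x => ?_)
    obtain ⟨b, rfl⟩ := Submodule.mkQ_surjective _ x
    obtain ⟨t, ht⟩ := b.2
    refine ⟨t, fun r hr => ?_⟩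
    rw [← map_smul, show r • b = 0 from Subtype.ext (ht r hr), map_zero]
end tors
section calg
variable {R : Type u} [CommRing R] [IsNoetherianRing R]

lemma LC_of_supp (a : Ideal R) (i : ℕ) (N : Type u) [AddCommGroup N] [Module R N]
    [hN : Module.Finite R N]
    (h : ∀ q ∈ Module.support R N, Subsingleton (LC a i (R ⧸ q.asIdeal))) :
    Subsingleton (LC a i N) := by
  revert h
  refine IsNoetherianRing.induction_on_isQuotientEquivQuotientPrime R hN
    (motive := fun N _ _ _ => (∀ q ∈ Module.support R N, Subsingleton (LC a i (R ⧸ q.asIdeal))) →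
      Subsingleton (LC a i N)) ?_ ?_ ?_
  · intro N _ _ _ _ _
    exact LC_subsingleton a i
  · intro N _ _ _ p e h
    refine LC_congr a i e.symm (h p ?_)
    rw [e.support_eq, Module.mem_support_iff_of_finite, Ideal.annihilator_quotient]
  · intro A _ _ _ B _ _ _ C _ _ _ f g hf hg hfg hA hC h
    rw [Module.support_of_exact hfg hf hg] at h
    exact LC_subs_mid a i hf hg hfg (hA fun q hq => h q (Or.inl hq)) (hC fun q hq => h q (Or.inr hq))

lemma supp_quot_lt (q : PrimeSpectrum R) (L : Submodule R (R ⧸ q.asIdeal)) (hL : L ≠ ⊥)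
    (q' : PrimeSpectrum R) (h : q' ∈ Module.support R ((R ⧸ q.asIdeal) ⧸ L)) : q < q' := by
  have h1 := Module.annihilator_le_of_mem_support h
  obtain ⟨y, hy, hy0⟩ := (Submodule.ne_bot_iff L).1 hL
  obtain ⟨r, rfl⟩ := Ideal.Quotient.mk_surjective y
  have hr : r ∉ q.asIdeal := fun hr => hy0 (Ideal.Quotient.eq_zero_iff_mem.2 hr)
  have hle : q.asIdeal ≤ q'.asIdeal := by
    refine le_trans ?_ h1
    intro s hs
    rw [Module.mem_annihilator]
    intro z
    obtain ⟨z, rfl⟩ := Submodule.mkQ_surjective _ z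
    obtain ⟨z, rfl⟩ := Ideal.Quotient.mk_surjective z
    rw [← map_smul]
    have : s • Ideal.Quotient.mk q.asIdeal z = Ideal.Quotient.mk q.asIdeal (s * z) := rfl
    rw [this, Ideal.Quotient.eq_zero_iff_mem.2 (Ideal.mul_mem_right _ _ hs), map_zero]
  have hr' : r ∈ q'.asIdeal := by
    apply h1
    rw [Module.mem_annihilator]
    intro z
    obtain ⟨z, rfl⟩ := Submodule.mkQ_surjective _ z
    obtain ⟨z, rfl⟩ := Ideal.Quotient.mk_surjective z
    rw [← map_smul]
    have : r • Ideal.Quotient.mk q.asIdeal z = z • Ideal.Quotient.mk q.asIdeal r := by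
      change Ideal.Quotient.mk q.asIdeal (r * z) = Ideal.Quotient.mk q.asIdeal (z * r)
      rw [mul_comm]
    rw [this, Submodule.mkQ_apply, Submodule.Quotient.mk_eq_zero]
    exact L.smul_mem z hy
  exact lt_of_le_of_ne hle (fun h => hr (h ▸ hr'))

/-- multiplication by an element -/
abbrev mulx (q : PrimeSpectrum R) (x : R) : (R ⧸ q.asIdeal) →ₗ[R] (R ⧸ q.asIdeal) :=
  x • LinearMap.id

lemma mulx_inj (q : PrimeSpectrum R) {x : R} (hx : x ∉ q.asIdeal) : Function.Injective (mulx q x) := by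
  rw [injective_iff_map_eq_zero]
  intro y hy
  obtain ⟨y, rfl⟩ := Ideal.Quotient.mk_surjective y
  have : Ideal.Quotient.mk q.asIdeal (x * y) = 0 := hy
  rw [Ideal.Quotient.eq_zero_iff_mem] at this ⊢
  exact (q.2.mem_or_mem this).resolve_left hx

lemma mulx_range (q : PrimeSpectrum R) {x : R} (hx : x ∉ q.asIdeal) :
    LinearMap.range (mulx q x) ≠ ⊥ := by
  rw [Submodule.ne_bot_iff]
  refine ⟨Ideal.Quotient.mk _ (x * 1), ⟨Ideal.Quotient.mk _ 1, rfl⟩, ?_⟩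
  rw [mul_one]
  exact fun h => hx (Ideal.Quotient.eq_zero_iff_mem.1 h)

lemma LCmap_mulx (a : Ideal R) (i : ℕ) (q : PrimeSpectrum R) (x : R) (y : LC a i (R ⧸ q.asIdeal)) :
    LCmap a i (mulx q x) y = x • y := by
  rw [mulx, LCmap_smul, LCmap_id]

lemma grothendieck (a : Ideal R) (n : ℕ) : ∀ q : PrimeSpectrum R, Order.coheight q < (n : ℕ∞) →
    ∀ i ≥ n, Subsingleton (LC a i (R ⧸ q.asIdeal)) := by
  induction n with
  | zero => intro q hq; simp at hq
  | succ n ih =>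
    intro q hq i hi
    obtain ⟨j, rfl⟩ : ∃ j, i = j + 1 := ⟨i - 1, by lia⟩
    by_cases haq : a ≤ q.asIdeal
    · apply LC_of_torsion
      intro x
      refine ⟨1, fun r hr => ?_⟩
      obtain ⟨y, rfl⟩ := Ideal.Quotient.mk_surjective x
      exact Ideal.Quotient.eq_zero_iff_mem.2 (Ideal.mul_mem_right _ _ (haq (by simpa using hr)))
    · obtain ⟨x, hxa, hxq⟩ := SetLike.not_le_iff_exists.1 haq
      have hC : Subsingleton (LC a j ((R ⧸ q.asIdeal) ⧸ LinearMap.range (mulx q x))) := by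
        refine LC_of_supp a j _ fun q' hq' => ih q' ?_ j (by lia)
        have h1 := Order.coheight_add_one_le (supp_quot_lt q _ (mulx_range q hxq) q' hq')
        have h2 := h1.trans_lt hq
        push_cast at h2
        exact lt_of_add_lt_add_right h2
      have hinj := LC_inj a j (mulx_inj q hxq) (Submodule.mkQ_surjective _)
        (LinearMap.exact_map_mkQ_range _) hC
      refine subsingleton_of_forall_eq 0 fun y => ?_
      obtain ⟨t, ht⟩ := LC_torsion a _ y
      have hy := ht (x ^ t) (Ideal.pow_mem_pow hxa t)
      clear ht
      induction t with
      | zero => simpa using hy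
      | succ t iht =>
        apply iht
        apply hinj
        rw [LCmap_mulx, map_zero, ← mul_smul, ← pow_succ']
        exact hy

lemma exists_map (M : Type u) [AddCommGroup M] [Module R M] [Module.Finite R M] (q : PrimeSpectrum R)
    (hq : q ∈ Module.support R M) : ∃ f : M →ₗ[R] R ⧸ q.asIdeal, f ≠ 0 := by
  by_contra! hcon
  have : Subsingleton (M →ₗ[R] R ⧸ q.asIdeal) := subsingleton_of_forall_eq 0 hcon
  obtain ⟨r, hr, hreg⟩ := IsSMulRegular.subsingleton_linearMap_iff.1 this
  have hr' := Module.annihilator_le_of_mem_support hq hr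
  have h0 : (Ideal.Quotient.mk q.asIdeal 1) = 0 := by
    apply hreg
    change Ideal.Quotient.mk q.asIdeal (r * 1) = Ideal.Quotient.mk q.asIdeal (r * 0)
    rw [mul_one, mul_zero, map_zero]
    exact Ideal.Quotient.eq_zero_iff_mem.2 hr'
  exact q.2.ne_top ((Ideal.eq_top_iff_one _).2 (Ideal.Quotient.eq_zero_iff_mem.1 h0))

lemma LCmap_surj (a : Ideal R) (i : ℕ) {M : Type u} [AddCommGroup M] [Module R M] [Module.Finite R M]
    (q : PrimeSpectrum R) (f : M →ₗ[R] R ⧸ q.asIdeal) (hf : f ≠ 0)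
    (h1 : ∀ q' ∈ Module.support R M, Subsingleton (LC a (i+1) (R ⧸ q'.asIdeal)))
    (h2 : ∀ q' > q, Subsingleton (LC a i (R ⧸ q'.asIdeal))) :
    Function.Surjective (LCmap a i f) := by
  have hr : LinearMap.range f ≠ ⊥ := fun h => hf (LinearMap.range_eq_bot.1 h)
  have hK : Subsingleton (LC a (i+1) (LinearMap.ker f)) := LC_of_supp a _ _ fun q' hq' =>
    h1 q' (Module.support_subset_of_injective _ (LinearMap.ker f).injective_subtype hq')
  have hQ : Subsingleton (LC a i ((R ⧸ q.asIdeal) ⧸ LinearMap.range f)) :=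
    LC_of_supp a _ _ fun q' hq' => h2 q' (supp_quot_lt q _ hr q' hq')
  have s1 := LC_surj a i (f := (LinearMap.ker f).subtype) (g := f.rangeRestrict)
    (LinearMap.ker f).injective_subtype f.surjective_rangeRestrict
    (by intro x; simp [LinearMap.rangeRestrict, Subtype.ext_iff]) hK
  intro y
  obtain ⟨z, rfl⟩ := (LC_exact a i (f := (LinearMap.range f).subtype) (g := (LinearMap.range f).mkQ)
    (LinearMap.range f).injective_subtype (Submodule.mkQ_surjective _)
    (LinearMap.exact_subtype_mkQ _) y).1 (Subsingleton.elim _ _)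
  obtain ⟨w, rfl⟩ := s1 z
  exact ⟨w, by rw [← LCmap_comp, LinearMap.subtype_comp_codRestrict]⟩

lemma LC_supp_vanish [IsLocalRing R] (a : Ideal R) {M : Type u} [AddCommGroup M] [Module R M] [Module.Finite R M]
    (c : ℕ) (hM : ∀ i > c, Subsingleton (LC a i M)) :
    ∀ i > c, ∀ q ∈ Module.support R M, Subsingleton (LC a i (R ⧸ q.asIdeal)) := by
  obtain ⟨N0, hN0⟩ : ∃ N0 : ℕ, ∀ q : PrimeSpectrum R, Order.coheight q < (N0 : ℕ∞) := by
    have h := ringKrullDim_lt_top (R := R)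
    have h' := ringKrullDim_ne_bot (R := R)
    obtain ⟨d, hd⟩ : ∃ d : ℕ, ringKrullDim R = (d : ℕ∞) := by
      generalize ringKrullDim R = x at h h'
      induction x with
      | bot => exact absurd rfl h'
      | coe x =>
        induction x with
        | top => exact absurd h (lt_irrefl _)
        | coe x => exact ⟨x, rfl⟩
    refine ⟨d + 1, fun q => ?_⟩
    have := Order.coheight_le_krullDim q
    rw [← ringKrullDim, hd] at this
    have := WithBot.coe_le_coe.1 this
    refine this.trans_lt ?_
    exact_mod_cast Nat.lt_succ_self d
  have key : ∀ k i, c < i → N0 ≤ i + k → ∀ q ∈ Module.support R M, Subsingleton (LC a i (R ⧸ q.asIdeal)) := by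
    intro k
    induction k with
    | zero => intro i _ hi q _; exact grothendieck a N0 q (hN0 q) i hi
    | succ k ih =>
      intro i hi hk q
      have : WellFoundedGT (PrimeSpectrum R) :=
        StrictMono.wellFoundedGT (f := PrimeSpectrum.asIdeal) (fun _ _ h => h)
      induction q using WellFoundedGT.induction with
      | ind q ihq =>
        intro hq
        obtain ⟨f, hf⟩ := exists_map M q hq
        have hs := LCmap_surj a i q f hf (fun q' hq' => ih (i+1) (by lia) (by lia) q' hq')
          (fun q' hq' => ihq q' hq' (Module.mem_support_mono hq'.le hq))
        have := hM i hi
        exact hs.subsingleton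
  exact fun i hi q hq => key N0 i hi (by lia) q hq

lemma ann_LC (a : Ideal R) (c : ℕ) (p : PrimeSpectrum R) (hp : Order.coheight p = c)
    (hnt : Nontrivial (LC a c (R ⧸ p.asIdeal))) :
    Module.annihilator R (LC a c (R ⧸ p.asIdeal)) = p.asIdeal := by
  ext r
  rw [Module.mem_annihilator]
  constructor
  · intro h
    by_contra hr
    have hC : Subsingleton (LC a c ((R ⧸ p.asIdeal) ⧸ LinearMap.range (mulx p r))) := by
      refine LC_of_supp a c _ fun q' hq' => grothendieck a c q' ?_ c le_rfl
      have h1 := Order.coheight_add_one_le (supp_quot_lt p _ (mulx_range p hr) q' hq')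
      rw [hp] at h1
      exact (ENat.add_one_le_iff (fun h => by simp [h] at h1)).1 h1
    obtain ⟨y, hy⟩ := exists_ne (0 : LC a c (R ⧸ p.asIdeal))
    obtain ⟨z, hz⟩ := (LC_exact a c (mulx_inj p hr) (Submodule.mkQ_surjective _)
        (LinearMap.exact_map_mkQ_range _) y).1 (Subsingleton.elim _ _)
    rw [LCmap_mulx, h] at hz
    exact hy hz.symm
  · intro hr y
    rw [← LCmap_mulx]
    have : mulx p r = 0 := by
      refine LinearMap.ext fun z => ?_
      obtain ⟨z, rfl⟩ := Ideal.Quotient.mk_surjective z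
      exact Ideal.Quotient.eq_zero_iff_mem.2 (Ideal.mul_mem_right _ _ hr)
    rw [this, LCmap_zero]

lemma mem_Att [IsLocalRing R] (a : Ideal R) {M : Type u} [AddCommGroup M] [Module R M] [Module.Finite R M]
    (c : ℕ) (hM : ∀ i > c, Subsingleton (LC a i M)) (p : PrimeSpectrum R)
    (hpM : p ∈ Module.support R M) (hp : Order.coheight p = c)
    (hnt : Nontrivial (LC a c (R ⧸ p.asIdeal))) : p.asIdeal ∈ Att R (LC a c M) := by
  obtain ⟨f, hf⟩ := exists_map M p hpM
  have hs := LCmap_surj a c p f hf (LC_supp_vanish a c hM (c+1) (by lia))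
    (fun q' hq' => grothendieck a c q' (by
      have h1 := Order.coheight_add_one_le hq'
      rw [hp] at h1
      exact (ENat.add_one_le_iff (fun h => by simp [h] at h1)).1 h1) c le_rfl)
  refine ⟨p.2, LinearMap.ker (LCmap a c f), ?_⟩
  rw [((LCmap a c f).quotKerEquivOfSurjective hs).annihilator_eq, ann_LC a c p hp hnt]

lemma LC_eq_smul (a : Ideal R) {M : Type u} [AddCommGroup M] [Module R M] [Module.Finite R M]
    (c : ℕ) (q : Ideal R)
    (h1 : ∀ q' ∈ Module.support R M, Subsingleton (LC a (c+1) (R ⧸ q'.asIdeal)))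
    (h2 : Subsingleton (LC a c (M ⧸ (q • ⊤ : Submodule R M)))) (x : LC a c M) :
    x ∈ q • (⊤ : Submodule R (LC a c M)) := by
  obtain ⟨s, rfl⟩ := IsNoetherian.noetherian q
  let φ : (s → M) →ₗ[R] M := ∑ r : s, (r : R) • LinearMap.proj r
  have hφ : LinearMap.range φ = Ideal.span (s : Set R) • ⊤ := by
    apply le_antisymm
    · rintro _ ⟨y, rfl⟩
      simp only [φ, LinearMap.sum_apply, LinearMap.smul_apply]
      exact Submodule.sum_mem _ fun r _ => Submodule.smul_mem_smul (Ideal.subset_span r.2) trivial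
    · rw [Submodule.smul_le]
      intro r hr m _
      induction hr using Submodule.span_induction with
      | mem r hr =>
        classical
        refine ⟨Pi.single ⟨r, hr⟩ m, ?_⟩
        simp only [φ, LinearMap.sum_apply, LinearMap.smul_apply, LinearMap.proj_apply]
        rw [Finset.sum_eq_single ⟨r, hr⟩]
        · simp
        · intro b _ hb
          rw [Pi.single_eq_of_ne hb, smul_zero]
        · simp
      | zero => simp
      | add r r' _ _ h1 h2 => rw [add_smul]; exact Submodule.add_mem _ h1 h2
      | smul c r _ h1 => rw [smul_eq_mul, mul_smul]; exact Submodule.smul_mem _ c h1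
  have hK : Subsingleton (LC a (c+1) (LinearMap.ker φ)) := LC_of_supp a _ _ fun q' hq' => h1 q' (by
    rw [Module.mem_support_iff_of_finite] at hq' ⊢
    refine le_trans ?_ hq'
    intro r hr
    rw [Module.mem_annihilator] at hr ⊢
    intro y
    ext j
    simp [hr])
  have hQ : Subsingleton (LC a c (M ⧸ LinearMap.range φ)) := by rw [hφ]; exact h2
  have s1 := LC_surj a c (f := (LinearMap.ker φ).subtype) (g := φ.rangeRestrict)
    (LinearMap.ker φ).injective_subtype φ.surjective_rangeRestrict
    (by intro x; simp [LinearMap.rangeRestrict, Subtype.ext_iff]) hK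
  obtain ⟨z, rfl⟩ := (LC_exact a c (f := (LinearMap.range φ).subtype) (g := (LinearMap.range φ).mkQ)
    (LinearMap.range φ).injective_subtype (Submodule.mkQ_surjective _)
    (LinearMap.exact_subtype_mkQ _) x).1 (Subsingleton.elim _ _)
  obtain ⟨w, rfl⟩ := s1 z
  rw [← LCmap_comp, LinearMap.subtype_comp_codRestrict]
  have : ∀ w, LCmap a c φ w ∈ Ideal.span (s : Set R) • (⊤ : Submodule R (LC a c M)) := by
    refine Finset.sum_induction _ (fun φ : (s → M) →ₗ[R] M => ∀ w, LCmap a c φ w ∈ Ideal.span (s : Set R) • (⊤ : Submodule R (LC a c M))) ?_ ?_ ?_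
    · intro f g hf hg w
      rw [LCmap_add]
      exact Submodule.add_mem _ (hf w) (hg w)
    · intro w
      rw [LCmap_zero]
      exact Submodule.zero_mem _
    · intro r _ w
      rw [LCmap_smul]
      exact Submodule.smul_mem_smul (Ideal.subset_span r.2) trivial
  exact this w

lemma of_mem_Att (a : Ideal R) {M : Type u} [AddCommGroup M] [Module R M] [Module.Finite R M]
    (c : ℕ) (hd : ∀ q ∈ Module.support R M, Order.coheight q ≤ (c : ℕ∞)) (q : Ideal R)
    (hq : q ∈ Att R (LC a c M)) : ∃ p ∈ Module.support R M, p.asIdeal = q ∧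
      q ∈ associatedPrimes R M ∧ Order.coheight p = c ∧ Nontrivial (LC a c (R ⧸ q)) := by
  obtain ⟨hqp, U, hU⟩ := hq
  have hann : Module.annihilator R M ≤ q := by
    intro r hr
    rw [hU, Module.mem_annihilator]
    intro x
    obtain ⟨x, rfl⟩ := Submodule.mkQ_surjective _ x
    have : r • (LinearMap.id : M →ₗ[R] M) = 0 := LinearMap.ext fun m => Module.mem_annihilator.1 hr m
    rw [← map_smul, ← LCmap_id a c x, ← LCmap_smul, this, LCmap_zero, map_zero]
  let p : PrimeSpectrum R := ⟨q, hqp⟩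
  have hp : p ∈ Module.support R M := Module.mem_support_iff_of_finite.2 hann
  have h1 : ∀ q' ∈ Module.support R M, Subsingleton (LC a (c+1) (R ⧸ q'.asIdeal)) :=
    fun q' hq' => grothendieck a (c+1) q' ((hd q' hq').trans_lt (by exact_mod_cast Nat.lt_succ_self c)) _ le_rfl
  have h2 : ¬ Subsingleton (LC a c (M ⧸ (q • ⊤ : Submodule R M))) := by
    intro h2
    have hle : q • (⊤ : Submodule R (LC a c M)) ≤ U := by
      rw [Submodule.smul_le]
      intro r hr x _
      rw [hU, Module.mem_annihilator] at hr
      have := hr (U.mkQ x)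
      rwa [← map_smul, Submodule.mkQ_apply, Submodule.Quotient.mk_eq_zero] at this
    apply hqp.ne_top
    rw [Ideal.eq_top_iff_one, hU, Module.mem_annihilator]
    intro x
    obtain ⟨x, rfl⟩ := Submodule.mkQ_surjective _ x
    rw [one_smul, Submodule.mkQ_apply, Submodule.Quotient.mk_eq_zero]
    exact hle (LC_eq_smul a c q h1 h2 x)
  obtain ⟨q', hq', hnt⟩ : ∃ q' ∈ Module.support R (M ⧸ (q • ⊤ : Submodule R M)), ¬ Subsingleton (LC a c (R ⧸ q'.asIdeal)) := by
    by_contra! hcon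
    exact h2 (LC_of_supp a c _ hcon)
  rw [Module.support_quotient] at hq'
  have hc : (c : ℕ∞) ≤ Order.coheight q' := by
    by_contra! hlt
    exact hnt (grothendieck a c q' hlt c le_rfl)
  have hnlt : ∀ p1 ∈ Module.support R M, ¬ p1 < q' := by
    intro p1 hp1 hlt
    have h3 := (add_le_add_left hc 1).trans ((Order.coheight_add_one_le hlt).trans (hd p1 hp1))
    have h4 : c + 1 ≤ c := by exact_mod_cast h3
    lia
  have hpq : p = q' := by
    have : p ≤ q' := hq'.2
    exact this.eq_or_lt.resolve_right (hnlt p hp)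
  refine ⟨p, hp, rfl, ?_, le_antisymm (hd p hp) (hpq ▸ hc), ?_⟩
  · apply Module.associatedPrimes.minimalPrimes_annihilator_subset_associatedPrimes
    refine ⟨⟨hqp, hann⟩, ?_⟩
    rintro J ⟨hJ, hJ'⟩ hle
    have := hnlt ⟨J, hJ⟩ (Module.mem_support_iff_of_finite.2 hJ')
    rw [← hpq] at this
    by_contra hcon
    exact this (lt_of_le_not_ge hle hcon)
  · rw [← hpq] at hnt
    exact not_subsingleton_iff_nontrivial.1 hnt

lemma mdim_quot (p : PrimeSpectrum R) : mdim R (R ⧸ p.asIdeal) = Order.coheight p := by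
  rw [Order.coheight_eq_krullDim_Ici, mdim]
  have : Module.support R (R ⧸ p.asIdeal) = Set.Ici p := by
    rw [Module.support_eq_zeroLocus, Ideal.annihilator_quotient]
    rfl
  rw [this]

lemma coheight_le_mdim (M : Type u) [AddCommGroup M] [Module R M] (q : PrimeSpectrum R)
    (hq : q ∈ Module.support R M) : (Order.coheight q : WithBot ℕ∞) ≤ mdim R M := by
  rw [Order.coheight_eq_krullDim_Ici, mdim]
  exact Order.krullDim_le_of_strictMono
    (fun x : Set.Ici q => (⟨x.1, Module.mem_support_mono x.2 hq⟩ : Module.support R M)) (fun _ _ h => h)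

lemma cohDim_vanish (a : Ideal R) (M : Type u) [AddCommGroup M] [Module R M] (c : ℕ)
    (hc : cohDim R a M = (c : ℕ∞)) : ∀ i > c, Subsingleton (LC a i M) := by
  intro i hi
  by_contra h
  have := le_sSup (show ((i : ℕ∞) : WithBot ℕ∞) ∈ { x : WithBot ℕ∞ | ∃ i : ℕ, x = (i : ℕ∞) ∧ Nontrivial (LC a i M) } from
    ⟨i, rfl, not_subsingleton_iff_nontrivial.1 h⟩)
  rw [← cohDim, hc] at this
  have := WithBot.coe_le_coe.1 this
  have h4 : i ≤ c := by exact_mod_cast this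
  lia

lemma cohDim_nontrivial (a : Ideal R) (M : Type u) [AddCommGroup M] [Module R M] (c : ℕ)
    (hc : cohDim R a M = (c : ℕ∞)) : Nontrivial (LC a c M) := by
  by_contra h
  have h0 := cohDim_vanish a M c hc
  cases c with
  | zero =>
    have : { x : WithBot ℕ∞ | ∃ i : ℕ, x = (i : ℕ∞) ∧ Nontrivial (LC a i M) } = ∅ := by
      rw [Set.eq_empty_iff_forall_notMem]
      rintro x ⟨i, rfl, hi⟩
      rcases Nat.eq_zero_or_pos i with rfl | hi'
      · exact h hi
      · exact not_nontrivial_iff_subsingleton.2 (h0 i hi') hi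
    rw [cohDim, this, sSup_empty] at hc
    exact WithBot.bot_ne_coe hc
  | succ c =>
    have : cohDim R a M ≤ ((c : ℕ∞) : WithBot ℕ∞) := by
      apply sSup_le
      rintro x ⟨i, rfl, hi⟩
      have : i ≤ c := by
        by_contra! hlt
        rcases Nat.eq_or_lt_of_le (Nat.succ_le_of_lt hlt) with h' | h'
        · subst h'; exact h hi
        · exact not_nontrivial_iff_subsingleton.2 (h0 i h') hi
      exact_mod_cast this
    rw [hc] at this
    have := WithBot.coe_le_coe.1 this
    have h4 : c + 1 ≤ c := by exact_mod_cast this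
    lia

lemma cohDim_eq (a : Ideal R) (M : Type u) [AddCommGroup M] [Module R M] (c : ℕ)
    (h1 : Nontrivial (LC a c M)) (h2 : ∀ i > c, Subsingleton (LC a i M)) :
    cohDim R a M = (c : ℕ∞) := by
  apply le_antisymm
  · apply sSup_le
    rintro x ⟨i, rfl, hi⟩
    have : i ≤ c := by
      by_contra! hlt
      exact not_nontrivial_iff_subsingleton.2 (h2 i hlt) hi
    exact_mod_cast this
  · exact le_sSup ⟨c, rfl, h1⟩
end calg

theorem stmt16 (R : Type u) [CommRing R] [IsNoetherianRing R] [IsLocalRing R]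
    (a : Ideal R) (ha : a ≠ ⊤)
    (M : Type u) [AddCommGroup M] [Module R M] [Module.Finite R M]
    (c : ℕ) (hc : cohDim R a M = (c : ℕ∞)) :
    { p : Ideal R | p ∈ associatedPrimes R M ∧
        cohDim R a (R ⧸ p) = (c : ℕ∞) ∧ mdim R (R ⧸ p) = (c : ℕ∞) } ⊆
      Att R (LC a c M) ∧
    (mdim R M = (c : ℕ∞) →
      { p : Ideal R | p ∈ associatedPrimes R M ∧
          cohDim R a (R ⧸ p) = (c : ℕ∞) ∧ mdim R (R ⧸ p) = (c : ℕ∞) } =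
        Att R (LC a c M)) := by
  have key : { p : Ideal R | p ∈ associatedPrimes R M ∧
        cohDim R a (R ⧸ p) = (c : ℕ∞) ∧ mdim R (R ⧸ p) = (c : ℕ∞) } ⊆
      Att R (LC a c M) := by
    rintro p ⟨hp1, hp2, hp3⟩
    let P : PrimeSpectrum R := ⟨p, hp1.isPrime⟩
    have hP : p = P.asIdeal := rfl
    rw [hP, mdim_quot P] at hp3
    refine mem_Att a c (cohDim_vanish a M c hc) P ?_ (WithBot.coe_injective hp3)
      (cohDim_nontrivial a _ c hp2)
    exact Module.mem_support_iff_of_finite.2 (Submodule.annihilator_top.symm.le.trans hp1.annihilator_le)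
  refine ⟨key, fun hd => Set.Subset.antisymm key ?_⟩
  intro q hq
  have hd' : ∀ q ∈ Module.support R M, Order.coheight q ≤ (c : ℕ∞) := fun q hq =>
    WithBot.coe_le_coe.1 ((coheight_le_mdim M q hq).trans_eq hd)
  obtain ⟨p, hp, rfl, hass, hcoh, hnt⟩ := of_mem_Att a c hd' q hq
  refine ⟨hass, cohDim_eq a _ c hnt fun i hi => ?_, ?_⟩
  · refine grothendieck a (c+1) p ?_ i hi
    rw [hcoh]
    exact_mod_cast Nat.lt_succ_self c
  · rw [mdim_quot, hcoh]

end
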